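/- arXiv:1512.02940 — 3 statements merged into one kernel-verified Lean document; each statement's English description precedes it below -/
import Mathlib

section
/- Let n ≥ 3 and let v_0,…,v_n be affinely independent points in ℝ^n forming an n-simplex S all of whose facets are nonobtuse. Then every vertex Gramian G of S is completely positive with cp-rank n, i.e., G = Pᵀ P for some entrywise nonnegative n×n matrix P (equivalently, S can be isometrically embedded in the nonnegative orthant of ℝ^n with any prescribed vertex at the origin). -/
open Matrix Finset
open scoped RealInnerProductSpace

noncomputable section

/-- The vertex Gramian of the simplex with vertices `v` associated with vertex `v ℓ`. -/
def vGram {n : ℕ} (v : Fin (n + 1) → EuclideanSpace ℝ (Fin n)) (ℓ : Fin (n + 1)) :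
    Matrix {k : Fin (n + 1) // k ≠ ℓ} {k : Fin (n + 1) // k ≠ ℓ} ℝ :=
  Matrix.of fun i j => ⟪v i.1 - v ℓ, v j.1 - v ℓ⟫

/-- A Stieltjes matrix: symmetric positive definite with nonpositive off-diagonal entries. -/
def IsStieltjes {ι : Type*} [Fintype ι] (M : Matrix ι ι ℝ) : Prop :=
  M.PosDef ∧ ∀ i j, i ≠ j → M i j ≤ 0

/-- Weakly diagonally dominant: `M e ≥ 0` entrywise for the all-ones vector `e`. -/
def IsWDD {ι : Type*} [Fintype ι] (M : Matrix ι ι ℝ) : Prop :=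
  ∀ i, 0 ≤ ∑ j, M i j

/-- Pointwise weakly diagonally dominant: each diagonal entry is maximal in its row. -/
def PWDD {ι : Type*} (M : Matrix ι ι ℝ) : Prop :=
  ∀ i j, M i j ≤ M i i

/-- The orthogonal projection of `x` onto the affine span of `{v k : k ∈ s}`
lies in the convex hull of `{v k : k ∈ s}`. -/
def ProjInHull {n : ℕ} (x : EuclideanSpace ℝ (Fin n))
    (v : Fin (n + 1) → EuclideanSpace ℝ (Fin n)) (s : Set (Fin (n + 1))) : Prop :=
  ∃ p ∈ convexHull ℝ (v '' s), ∀ a ∈ s, ∀ b ∈ s, ⟪x - p, v a - v b⟫ = 0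

/-- All facets of the simplex are nonobtuse: each vertex `v i` projects, for each `j ≠ i`,
into the convex hull of the vertices other than `v i, v j`. -/
def FacetsNonobtuse {n : ℕ} (v : Fin (n + 1) → EuclideanSpace ℝ (Fin n)) : Prop :=
  ∀ i j : Fin (n + 1), i ≠ j → ProjInHull (v i) v {k | k ≠ i ∧ k ≠ j}

/-- `q` is an inward normal to the facet opposite `v j`. -/
def IsInwardNormal {n : ℕ} (v : Fin (n + 1) → EuclideanSpace ℝ (Fin n)) (j : Fin (n + 1))
    (q : EuclideanSpace ℝ (Fin n)) : Prop :=
  q ≠ 0 ∧ (∀ a b : Fin (n + 1), a ≠ j → b ≠ j → ⟪q, v a - v b⟫ = 0) ∧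
    ∀ k : Fin (n + 1), k ≠ j → 0 < ⟪q, v j - v k⟫

/-- The `j`-th column of `A` is a blocking column: no off-diagonal entry of column `j`
is minimal in its row. -/
def IsBlockingCol {ι : Type*} (A : Matrix ι ι ℝ) (j : ι) : Prop :=
  ∀ i, i ≠ j → ∃ k, A i k < A i j

/-- `A` is nonblocking: every column has an off-diagonal entry minimal in its row. -/
def IsNonblocking {ι : Type*} (A : Matrix ι ι ℝ) : Prop :=
  ∀ j, ∃ i, i ≠ j ∧ ∀ k, A i j ≤ A i k

/-- A (symmetric nonnegative) ultrametric matrix. -/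
def IsUltra {ι : Type*} (A : Matrix ι ι ℝ) : Prop :=
  (∀ i j, 0 ≤ A i j) ∧ (∀ i j, A i j ≤ A i i) ∧ ∀ i j k, min (A i k) (A k j) ≤ A i j

/-- The principal submatrix of `A` with rows and columns restricted to `s`. -/
def subMat {ι : Type*} (A : Matrix ι ι ℝ) (s : Finset ι) :
    Matrix {x // x ∈ s} {x // x ∈ s} ℝ :=
  A.submatrix (fun i => i.1) (fun j => j.1)

/-- The principal submatrix of `A` obtained by deleting row and column `m`. -/
def delMat {ι : Type*} (A : Matrix ι ι ℝ) (m : ι) : Matrix {i // i ≠ m} {i // i ≠ m} ℝ :=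
  A.submatrix (fun i => i.1) (fun j => j.1)

section Tetra

variable {V : Type*} [NormedAddCommGroup V] [InnerProductSpace ℝ V]

/-- The triangle with vertices `a, b, c` is nonobtuse. -/
def NonobtuseTri (a b c : V) : Prop :=
  0 ≤ ⟪b - a, c - a⟫ ∧ 0 ≤ ⟪a - b, c - b⟫ ∧ 0 ≤ ⟪a - c, b - c⟫

/-- The sub-orthocentric set of the triangle `a b c`: the union over the vertices of the
closed segments from the vertex to the orthocenter. -/
def SubOrthoSet (a b c : V) : Set V :=
  {x | ∃ h, h ∈ affineSpan ℝ ({a, b, c} : Set V) ∧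
    ⟪h - a, b - c⟫ = 0 ∧ ⟪h - b, a - c⟫ = 0 ∧
    (x ∈ segment ℝ a h ∨ x ∈ segment ℝ b h ∨ x ∈ segment ℝ c h)}

/-- `p` is the orthogonal projection of `x` onto the affine span of `{a, b, c}`. -/
def IsOrthProjTri (x p a b c : V) : Prop :=
  p ∈ affineSpan ℝ ({a, b, c} : Set V) ∧ ⟪x - p, b - a⟫ = 0 ∧ ⟪x - p, c - a⟫ = 0

/-- A sub-orthocentric tetrahedron: all triangular faces are nonobtuse and each vertex
projects orthogonally into the sub-orthocentric set of its opposite face. -/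
def IsSubOrthoTetra (w : Fin 4 → V) : Prop :=
  ∀ i : Fin 4,
    NonobtuseTri (w (i.succAbove 0)) (w (i.succAbove 1)) (w (i.succAbove 2)) ∧
    ∃ p, IsOrthProjTri (w i) p (w (i.succAbove 0)) (w (i.succAbove 1)) (w (i.succAbove 2)) ∧
      p ∈ SubOrthoSet (w (i.succAbove 0)) (w (i.succAbove 1)) (w (i.succAbove 2))

end Tetra

section GramFactorization

variable {ι E : Type*} [NormedAddCommGroup E] [InnerProductSpace ℝ E]

/-- The Gram matrix of the vectors indexed by `s` has a square entrywise nonnegative factor. -/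
def GramFactors (u : ι → E) (s : Finset ι) : Prop :=
  ∃ P : ι → ι → ℝ, (∀ r i, 0 ≤ P r i) ∧
    ∀ i ∈ s, ∀ j ∈ s, ⟪u i, u j⟫ = ∑ r ∈ s, P r i * P r j

/-- The components of the vectors `u j` orthogonal to `u p`. -/
def orthPart (u : ι → E) (p j : ι) : E := u j - (⟪u j, u p⟫ / ⟪u p, u p⟫) • u p

lemma inner_orthPart_pivot (u : ι → E) (p j : ι) : ⟪orthPart u p j, u p⟫ = 0 := by
  rw [orthPart, inner_sub_left, real_inner_smul_left]
  by_cases h : ⟪u p, u p⟫ = 0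
  · have : u p = 0 := inner_self_eq_zero.mp h
    simp [this]
  · field_simp
    ring

lemma inner_eq_inner_orthPart_add (u : ι → E) (p i j : ι) :
    ⟪u i, u j⟫ = ⟪orthPart u p i, orthPart u p j⟫ + ⟪u i, u p⟫ * ⟪u j, u p⟫ / ⟪u p, u p⟫ := by
  have h : ⟪orthPart u p i, orthPart u p j⟫ = ⟪orthPart u p i, u j⟫ := by
    conv_lhs => rw [orthPart.eq_def u p j, inner_sub_right, real_inner_smul_right,
      inner_orthPart_pivot]
    ring
  rw [h, orthPart, inner_sub_left, real_inner_smul_left, real_inner_comm (u j) (u p)]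
  ring

lemma orthPart_self (u : ι → E) (p : ι) : orthPart u p p = 0 := by
  by_cases h : u p = 0
  · simp [orthPart, h]
  · rw [orthPart, div_self (inner_self_ne_zero.mpr h), one_smul, sub_self]

variable [DecidableEq ι]

/-- Each vector indexed by `t` projects orthogonally onto the span of the other vectors indexed
by `t` with nonnegative coefficients. -/
def ProjNonneg (u : ι → E) (t : Finset ι) : Prop :=
  ∀ i ∈ t, ∃ c : ι → ℝ, (∀ j, 0 ≤ c j) ∧
    ∀ k ∈ t.erase i, ⟪u i - ∑ j ∈ t.erase i, c j • u j, u k⟫ = 0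

lemma GramFactors.of_orthPart {u : ι → E} {s : Finset ι} {p : ι} (hp : p ∈ s)
    (hnn : ∀ i ∈ s, 0 ≤ ⟪u i, u p⟫) (h : GramFactors (orthPart u p) (s.erase p)) :
    GramFactors u s := by
  obtain ⟨P, hP, hG⟩ := h
  refine ⟨fun r i => if r = p then (if i ∈ s then ⟪u i, u p⟫ / √⟪u p, u p⟫ else 0)
    else if i = p then 0 else P r i, ?_, ?_⟩
  · intro r i
    dsimp only
    split_ifs with h1 h2 h3
    · exact div_nonneg (hnn i h2) (Real.sqrt_nonneg _)
    · exact le_rfl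
    · exact le_rfl
    · exact hP r i
  · intro i hi j hj
    rw [← Finset.add_sum_erase s _ hp, inner_eq_inner_orthPart_add u p i j]
    simp only [if_true, if_pos hi, if_pos hj]
    rw [div_mul_div_comm, Real.mul_self_sqrt real_inner_self_nonneg, add_comm]
    congr 1
    have hr : ∀ r ∈ s.erase p, (if r = p then ⟪u i, u p⟫ / √⟪u p, u p⟫
        else if i = p then 0 else P r i) * (if r = p then ⟪u j, u p⟫ / √⟪u p, u p⟫
        else if j = p then 0 else P r j) =
        (if i = p then 0 else P r i) * (if j = p then 0 else P r j) := by
      intro r hr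
      rw [if_neg (Finset.ne_of_mem_erase hr), if_neg (Finset.ne_of_mem_erase hr)]
    rw [Finset.sum_congr rfl hr]
    by_cases hip : i = p
    · subst hip; simp [orthPart_self]
    by_cases hjp : j = p
    · subst hjp; simp [orthPart_self]
    simp only [if_neg hip, if_neg hjp]
    exact hG i (Finset.mem_erase.mpr ⟨hip, hi⟩) j (Finset.mem_erase.mpr ⟨hjp, hj⟩)

lemma gramFactors_pair {u : ι → E} {a b : ι} (hab : a ≠ b) (h : 0 ≤ ⟪u a, u b⟫) :
    GramFactors u {a, b} := by
  refine .of_orthPart (p := b) (by simp) ?_ ?_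
  · intro i hi
    rcases Finset.mem_insert.mp hi with rfl | hi
    · exact h
    · rw [Finset.mem_singleton.mp hi]; exact real_inner_self_nonneg
  · have hs : ({a, b} : Finset ι).erase b = {a} := by
      ext x; simp only [Finset.mem_erase, Finset.mem_insert, Finset.mem_singleton]; grind
    rw [hs]
    refine .of_orthPart (p := a) (by simp) ?_ ?_
    · intro i hi
      rw [Finset.mem_singleton.mp hi]; exact real_inner_self_nonneg
    · exact ⟨0, by simp, by simp⟩

lemma gramFactors_triple_of_pivot {u : ι → E} {a b c : ι} (hab : a ≠ b) (hac : a ≠ c)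
    (hbc : b ≠ c) (h1 : 0 ≤ ⟪u a, u b⟫) (h2 : 0 ≤ ⟪u a, u c⟫) (h3 : 0 ≤ ⟪u b, u c⟫)
    (h : ⟪u a, u b⟫ * ⟪u a, u c⟫ ≤ ⟪u a, u a⟫ * ⟪u b, u c⟫) : GramFactors u {a, b, c} := by
  refine .of_orthPart (p := a) (by simp) ?_ ?_
  · intro i hi
    simp only [Finset.mem_insert, Finset.mem_singleton] at hi
    rcases hi with rfl | rfl | rfl
    · exact real_inner_self_nonneg
    · rwa [real_inner_comm]
    · rwa [real_inner_comm]
  · rw [Finset.erase_insert (by simp [hab, hac])]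
    refine gramFactors_pair hbc ?_
    have := inner_eq_inner_orthPart_add u a b c
    rw [real_inner_comm (u a) (u b), real_inner_comm (u a) (u c)] at this
    rcases (real_inner_self_nonneg (x := u a)).eq_or_lt with h0 | h0
    · have ha : u a = 0 := inner_self_eq_zero.mp h0.symm
      simpa [orthPart, ha] using h3
    · have hle : ⟪u a, u b⟫ * ⟪u a, u c⟫ / ⟪u a, u a⟫ ≤ ⟪u b, u c⟫ := by
        rw [div_le_iff₀ h0]; linarith
      linarith

lemma gramFactors_triple {u : ι → E} {a b c : ι} (hab : a ≠ b) (hac : a ≠ c)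
    (hbc : b ≠ c) (h1 : 0 ≤ ⟪u a, u b⟫) (h2 : 0 ≤ ⟪u a, u c⟫) (h3 : 0 ≤ ⟪u b, u c⟫) :
    GramFactors u {a, b, c} := by
  by_cases ha : ⟪u a, u b⟫ * ⟪u a, u c⟫ ≤ ⟪u a, u a⟫ * ⟪u b, u c⟫
  · exact gramFactors_triple_of_pivot hab hac hbc h1 h2 h3 ha
  have h1' := real_inner_comm (u a) (u b)
  have h2' := real_inner_comm (u a) (u c)
  have h3' := real_inner_comm (u b) (u c)
  by_cases hb : ⟪u b, u a⟫ * ⟪u b, u c⟫ ≤ ⟪u b, u b⟫ * ⟪u a, u c⟫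
  · rw [Finset.insert_comm]
    exact gramFactors_triple_of_pivot hab.symm hbc hac (h1'.symm ▸ h1) h3 h2 hb
  exfalso
  rw [h1'] at hb
  push Not at ha hb
  have hCS := real_inner_mul_inner_self_le (u a) (u b)
  have hx := real_inner_self_nonneg (x := u a)
  have hy := real_inner_self_nonneg (x := u b)
  have hpos1 : 0 < ⟪u a, u c⟫ := by
    rcases h2.eq_or_lt with h | h
    · rw [← h] at ha; nlinarith [mul_nonneg hx h3]
    · exact h
  have hpos2 : 0 < ⟪u b, u c⟫ := by
    rcases h3.eq_or_lt with h | h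
    · rw [← h] at hb; nlinarith [mul_nonneg hy h2]
    · exact h
  have := mul_lt_mul'' ha hb (mul_nonneg hx h3) (mul_nonneg hy h2)
  nlinarith [mul_le_mul_of_nonneg_right hCS (mul_pos hpos1 hpos2).le]

lemma ProjNonneg.erase {u : ι → E} {t : Finset ι} (hli : LinearIndepOn ℝ u (t : Set ι))
    (h : ProjNonneg u t) {m : ι} (hm : m ∈ t) : ProjNonneg u (t.erase m) := by
  intro i hi
  have him : i ≠ m := Finset.ne_of_mem_erase hi
  have hit : i ∈ t := Finset.mem_of_mem_erase hi
  obtain ⟨c, hc, hcu⟩ := h i hit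
  obtain ⟨d, hd, hdu⟩ := h m hm
  have hmi : m ∈ t.erase i := Finset.mem_erase.mpr ⟨him.symm, hm⟩
  set X := u i - ∑ j ∈ t.erase i, c j • u j with hX
  set Y := u m - ∑ j ∈ t.erase m, d j • u j with hY
  have hX0 : X ≠ 0 := by
    intro h0
    rw [linearIndepOn_finset_iff] at hli
    have := hli (fun j => if j = i then 1 else - c j) (by
      rw [← Finset.add_sum_erase t _ hit]
      rw [← h0, hX, sub_eq_add_neg, ← Finset.sum_neg_distrib]
      simp only [if_true, one_smul]
      congr 1
      refine Finset.sum_congr rfl fun j hj => ?_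
      rw [if_neg (Finset.ne_of_mem_erase hj), neg_smul]) i hit
    simp at this
  have hXi : ⟪X, u i⟫ = ⟪X, X⟫ := by
    conv_rhs => rw [hX, inner_sub_right, ← hX]
    rw [inner_sum, Finset.sum_eq_zero, sub_zero]
    intro j hj
    rw [real_inner_smul_right, hcu j hj, mul_zero]
  set r := (t.erase m).erase i with hr
  have hr' : r = (t.erase i).erase m := Finset.erase_right_comm
  have hXe : X = u i - (c m • u m + ∑ j ∈ r, c j • u j) := by
    rw [hX, hr', Finset.add_sum_erase _ (fun j => c j • u j) hmi]
  have hYe : Y = u m - (d i • u i + ∑ j ∈ r, d j • u j) := by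
    rw [hY, hr, Finset.add_sum_erase _ (fun j => d j • u j) hi]
  set e := X + c m • Y with he
  have hek : ∀ k ∈ r, ⟪e, u k⟫ = 0 := by
    intro k hk
    rw [he, inner_add_left, real_inner_smul_left, hcu k (Finset.mem_of_mem_erase (hr' ▸ hk)),
      hdu k (Finset.mem_of_mem_erase hk)]
    simp
  have hei : ⟪e, u i⟫ = ⟪X, X⟫ := by
    rw [he, inner_add_left, real_inner_smul_left, hdu i hi, hXi]
    simp
  have hee : e = (1 - c m * d i) • u i - ∑ j ∈ r, (c j + c m * d j) • u j := by
    rw [he, hXe, hYe]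
    simp only [add_smul, Finset.sum_add_distrib, mul_smul, ← Finset.smul_sum]
    module
  have hXX : 0 < ⟪X, X⟫ := real_inner_self_pos.mpr hX0
  have he0 : e ≠ 0 := by
    intro h0
    rw [h0, inner_zero_left] at hei
    exact hXX.ne hei
  have hmul : ⟪e, e⟫ = (1 - c m * d i) * ⟪X, X⟫ := by
    conv_lhs => rw [hee, inner_sub_right, ← hee]
    rw [real_inner_smul_right, hei, inner_sum, Finset.sum_eq_zero, sub_zero]
    intro j hj
    rw [real_inner_smul_right, hek j hj, mul_zero]
  have hpos : 0 < 1 - c m * d i := by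
    have := real_inner_self_pos.mpr he0
    rw [hmul] at this
    exact pos_of_mul_pos_left this hXX.le
  refine ⟨fun j => (1 - c m * d i)⁻¹ * (c j + c m * d j), fun j => ?_, fun k hk => ?_⟩
  · exact mul_nonneg (inv_nonneg.mpr hpos.le) (add_nonneg (hc j) (mul_nonneg (hc m) (hd j)))
  · have : u i - ∑ j ∈ r, ((1 - c m * d i)⁻¹ * (c j + c m * d j)) • u j
        = (1 - c m * d i)⁻¹ • e := by
      rw [hee, smul_sub, smul_smul, inv_mul_cancel₀ hpos.ne', one_smul, Finset.smul_sum]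
      simp only [mul_smul]
    rw [this, real_inner_smul_left, hek k hk, mul_zero]

lemma ProjNonneg.inner_nonneg {u : ι → E} {t : Finset ι} (hli : LinearIndepOn ℝ u (t : Set ι))
    (h : ProjNonneg u t) {i j : ι} (hi : i ∈ t) (hj : j ∈ t) : 0 ≤ ⟪u i, u j⟫ := by
  by_cases hij : i = j
  · subst hij; exact real_inner_self_nonneg
  induction t using Finset.strongInduction with
  | H t ih =>
    by_cases hex : ∃ m ∈ t, m ≠ i ∧ m ≠ j
    · obtain ⟨m, hm, hmi, hmj⟩ := hex
      exact ih (t.erase m) (Finset.erase_ssubset hm)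
        (hli.mono (Finset.coe_subset.mpr (Finset.erase_subset m t))) (h.erase hli hm)
        (Finset.mem_erase.mpr ⟨hmi.symm, hi⟩) (Finset.mem_erase.mpr ⟨hmj.symm, hj⟩)
    · push Not at hex
      have ht : t.erase i = {j} := by
        ext x
        simp only [Finset.mem_erase, Finset.mem_singleton]
        exact ⟨fun hx => hex x hx.2 hx.1, fun hx => hx ▸ ⟨Ne.symm hij, hj⟩⟩
      obtain ⟨c, hc, hcu⟩ := h i hi
      have := hcu j (by simp [ht])
      rw [ht, Finset.sum_singleton, inner_sub_left, real_inner_smul_left] at this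
      have := mul_nonneg (hc j) (real_inner_self_nonneg (x := u j))
      linarith

lemma LinearIndepOn.orthPart {u : ι → E} {s : Finset ι} {p : ι} (hp : p ∈ s)
    (hli : LinearIndepOn ℝ u (s : Set ι)) :
    LinearIndepOn ℝ (orthPart u p) ((s.erase p : Finset ι) : Set ι) := by
  rw [linearIndepOn_finset_iff] at hli ⊢
  intro f hf i hi
  have := hli (fun j => if j = p then
      -∑ k ∈ s.erase p, f k * (⟪u k, u p⟫ / ⟪u p, u p⟫) else f j) (by
    rw [← Finset.add_sum_erase s _ hp, if_pos rfl, ← hf, neg_smul, Finset.sum_smul,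
      ← Finset.sum_neg_distrib, ← Finset.sum_add_distrib]
    refine Finset.sum_congr rfl fun j hj => ?_
    rw [if_neg (Finset.ne_of_mem_erase hj), _root_.orthPart]
    module) i (Finset.mem_of_mem_erase hi)
  simpa [Finset.ne_of_mem_erase hi] using this

lemma ProjNonneg.orthPart {u : ι → E} {t : Finset ι} {p : ι} (hp : p ∈ t)
    (h : ProjNonneg u t) : ProjNonneg (orthPart u p) (t.erase p) := by
  intro i hi
  have hip : i ≠ p := Finset.ne_of_mem_erase hi
  obtain ⟨c, hc, hcu⟩ := h i (Finset.mem_of_mem_erase hi)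
  refine ⟨c, hc, ?_⟩
  have hpi : p ∈ t.erase i := Finset.mem_erase.mpr ⟨hip.symm, hp⟩
  set X := u i - ∑ j ∈ t.erase i, c j • u j with hX
  obtain ⟨a, ha⟩ : ∃ a : ℝ, _root_.orthPart u p i -
      ∑ j ∈ (t.erase p).erase i, c j • _root_.orthPart u p j = X + a • u p := by
    refine ⟨c p - ⟪u i, u p⟫ / ⟪u p, u p⟫ +
      ∑ j ∈ (t.erase p).erase i, c j * (⟪u j, u p⟫ / ⟪u p, u p⟫), ?_⟩
    rw [hX, ← Finset.add_sum_erase (t.erase i) _ hpi, Finset.erase_right_comm, add_smul,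
      Finset.sum_smul]
    simp only [_root_.orthPart, smul_sub, Finset.sum_sub_distrib, smul_smul]
    module
  intro k hk
  have hkt : k ∈ t.erase i := Finset.mem_of_mem_erase (Finset.erase_right_comm (s := t) ▸ hk)
  rw [ha, inner_add_left, real_inner_smul_left, real_inner_comm (_root_.orthPart u p k) (u p),
    inner_orthPart_pivot, _root_.orthPart, inner_sub_right, real_inner_smul_right,
    hcu k hkt, hcu p hpi]
  simp

/-- If all maximal proper subfamilies of a linearly independent family have nonnegative
projection coefficients, then its Gram matrix has a square nonnegative factor. -/
theorem gramFactors_of_projNonneg_erase {u : ι → E} {s : Finset ι} (hs : 3 ≤ s.card)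
    (hli : LinearIndepOn ℝ u (s : Set ι)) (h : ∀ m ∈ s, ProjNonneg u (s.erase m)) :
    GramFactors u s := by
  induction s using Finset.strongInduction generalizing u with
  | H s ih =>
    have hnn : ∀ i ∈ s, ∀ j ∈ s, 0 ≤ ⟪u i, u j⟫ := by
      intro i hi j hj
      obtain ⟨m, hm, hmij⟩ := Finset.exists_mem_notMem_of_card_lt_card
        (s := {i, j}) (t := s) (Finset.card_le_two.trans_lt hs)
      simp only [Finset.mem_insert, Finset.mem_singleton, not_or] at hmij
      exact (h m hm).inner_nonneg
        (hli.mono (Finset.coe_subset.mpr (Finset.erase_subset m s)))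
        (Finset.mem_erase.mpr ⟨Ne.symm hmij.1, hi⟩) (Finset.mem_erase.mpr ⟨Ne.symm hmij.2, hj⟩)
    rcases hs.eq_or_lt with h3 | h4
    · obtain ⟨a, b, c, hab, hac, hbc, rfl⟩ := Finset.card_eq_three.mp h3.symm
      exact gramFactors_triple hab hac hbc (hnn _ (by simp) _ (by simp))
        (hnn _ (by simp) _ (by simp)) (hnn _ (by simp) _ (by simp))
    · obtain ⟨p, hp⟩ : s.Nonempty := Finset.card_pos.mp (by omega)
      refine .of_orthPart hp (fun i hi => hnn i hi p hp) ?_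
      refine ih _ (Finset.erase_ssubset hp) ?_ (hli.orthPart hp) fun m hm => ?_
      · rw [Finset.card_erase_of_mem hp]; omega
      · rw [Finset.erase_right_comm]
        exact (h m (Finset.mem_of_mem_erase hm)).orthPart
          (Finset.mem_erase.mpr ⟨(Finset.ne_of_mem_erase hm).symm, hp⟩)

end GramFactorization

lemma exists_nonneg_coeff_of_mem_convexHull {ι E : Type*} [DecidableEq ι] [AddCommGroup E]
    [Module ℝ E] (v : ι → E) (ℓ : ι) {s : Set ι} {t : Finset ι}
    (hst : ∀ k ∈ s, k ≠ ℓ → k ∈ t) {p : E} (hp : p ∈ convexHull ℝ (v '' s)) :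
    ∃ c : ι → ℝ, (∀ j, 0 ≤ c j) ∧ p - v ℓ = ∑ j ∈ t, c j • (v j - v ℓ) := by
  refine convexHull_min (t := {p | ∃ c : ι → ℝ, (∀ j, 0 ≤ c j) ∧
    p - v ℓ = ∑ j ∈ t, c j • (v j - v ℓ)}) ?_ ?_ hp
  · rintro _ ⟨k, hk, rfl⟩
    by_cases hkl : k = ℓ
    · exact ⟨0, fun _ => le_rfl, by simp [hkl]⟩
    · refine ⟨fun j => if j = k then 1 else 0, fun j => by positivity, ?_⟩
      simp [ite_smul, hst k hk hkl]
  · rintro x ⟨c, hc, hx⟩ y ⟨d, hd, hy⟩ a b ha hb hab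
    refine ⟨fun j => a * c j + b * d j,
      fun j => add_nonneg (mul_nonneg ha (hc j)) (mul_nonneg hb (hd j)), ?_⟩
    simp only [add_smul, mul_smul, Finset.sum_add_distrib, ← Finset.smul_sum, ← hx, ← hy]
    rw [smul_sub, smul_sub, sub_add_sub_comm, ← add_smul, hab, one_smul]

lemma FacetsNonobtuse.projNonneg {n : ℕ} {v : Fin (n + 1) → EuclideanSpace ℝ (Fin n)}
    (hfac : FacetsNonobtuse v) (ℓ m : Fin (n + 1)) (hm : m ≠ ℓ) :
    ProjNonneg (fun k => v k - v ℓ) ((univ.erase ℓ).erase m) := by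
  intro i hi
  simp only [Finset.mem_erase, Finset.mem_univ, and_true] at hi
  obtain ⟨p, hp, hort⟩ := hfac i m hi.1
  obtain ⟨c, hc, hpc⟩ := exists_nonneg_coeff_of_mem_convexHull v ℓ
    (t := ((univ.erase ℓ).erase m).erase i) (fun k hk hkl => by
      simp only [Set.mem_ofPred_eq] at hk
      simp [hk.1, hk.2, hkl]) hp
  refine ⟨c, hc, fun k hk => ?_⟩
  simp only [Finset.mem_erase, Finset.mem_univ, and_true] at hk
  rw [← hpc, sub_sub_sub_cancel_right]
  exact hort k ⟨hk.1, hk.2.1⟩ ℓ ⟨Ne.symm hi.2, hm.symm⟩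

theorem stmt12 (n : ℕ) (hn : 3 ≤ n) (v : Fin (n + 1) → EuclideanSpace ℝ (Fin n))
    (hv : AffineIndependent ℝ v) (hfac : FacetsNonobtuse v) (ℓ : Fin (n + 1)) :
    ∃ P : Matrix {k : Fin (n + 1) // k ≠ ℓ} {k : Fin (n + 1) // k ≠ ℓ} ℝ,
      (∀ i j, 0 ≤ P i j) ∧ vGram v ℓ = Pᵀ * P := by
  have hli : LinearIndepOn ℝ (fun k => v k - v ℓ)
      ((univ.erase ℓ : Finset (Fin (n + 1))) : Set (Fin (n + 1))) := by
    have hset : ((univ.erase ℓ : Finset (Fin (n + 1))) : Set (Fin (n + 1))) = {k | k ≠ ℓ} := by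
      ext; simp
    rw [hset]
    exact (affineIndependent_iff_linearIndependent_vsub ℝ v ℓ).mp hv
  obtain ⟨P, hP, hG⟩ := gramFactors_of_projNonneg_erase (by simpa using hn) hli
    fun m hm => hfac.projNonneg ℓ m (Finset.ne_of_mem_erase hm)
  refine ⟨Matrix.of fun i j => P i.1 j.1, fun i j => hP _ _, ?_⟩
  ext i j
  simp only [vGram, Matrix.mul_apply, Matrix.transpose_apply, Matrix.of_apply]
  rw [hG i (by simp [i.2]) j (by simp [j.2])]
  exact Finset.sum_subtype _ (by simp) _
end
end

section
/- Let n ≥ 3 and let v_0,…,v_n be affinely independent points in ℝ^n forming an n-simplex S. Then the following are equivalent: (i) there is a vertex v of S such that every 3-dimensional face of S containing v (the tetrahedron spanned by v and three other vertices) is sub-orthocentric; (ii) every 3-dimensional face of S is sub-orthocentric; (iii) some vertex Gramian of S is ultrametric; (iv) every vertex Gramian of S is ultrametric. -/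
open Matrix Finset
open scoped RealInnerProductSpace

noncomputable section

/-- The Gramian of the family `v` relative to the base point `v ℓ`, indexed by all of `ι`. -/
def baseGram {ι V : Type*} [NormedAddCommGroup V] [InnerProductSpace ℝ V] (v : ι → V) (ℓ : ι) :
    Matrix ι ι ℝ :=
  Matrix.of fun i j => ⟪v i - v ℓ, v j - v ℓ⟫

theorem IsUltra.submatrix {ι κ : Type*} {A : Matrix ι ι ℝ} (hA : IsUltra A) (f : κ → ι) :
    IsUltra (A.submatrix f f) :=
  ⟨fun _ _ => hA.1 _ _, fun _ _ => hA.2.1 _ _, fun _ _ _ => hA.2.2 _ _ _⟩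

section InnerProduct

variable {ι V : Type*} [NormedAddCommGroup V] [InnerProductSpace ℝ V]

theorem baseGram_symm (v : ι → V) (ℓ i j : ι) : baseGram v ℓ i j = baseGram v ℓ j i :=
  real_inner_comm _ _

theorem baseGram_self_right (v : ι → V) (ℓ i : ι) : baseGram v ℓ i ℓ = 0 := by
  simp [baseGram]

theorem baseGram_self_left (v : ι → V) (ℓ i : ι) : baseGram v ℓ ℓ i = 0 := by
  simp [baseGram]

theorem baseGram_diag_nonneg (v : ι → V) (ℓ i : ι) : 0 ≤ baseGram v ℓ i i :=
  real_inner_self_nonneg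

theorem baseGram_rebase (v : ι → V) (ℓ m i j : ι) :
    baseGram v m i j =
      baseGram v ℓ i j - baseGram v ℓ i m - baseGram v ℓ m j + baseGram v ℓ m m := by
  simp only [baseGram, Matrix.of_apply, inner_sub_left, inner_sub_right]
  ring

theorem baseGram_diag_sub (v : ι → V) (ℓ i j : ι) :
    baseGram v ℓ i i - baseGram v ℓ i j = baseGram v i ℓ j := by
  rw [baseGram_rebase v ℓ i ℓ j, baseGram_self_left, baseGram_self_left]
  ring

/-- The four-point condition for an ultrametric matrix. -/
theorem IsUltra.four_point {A : Matrix ι ι ℝ} (hA : IsUltra A) (hs : ∀ i j, A i j = A j i)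
    (a b c d : ι) : min (A a c + A b d) (A a d + A b c) ≤ A a b + A c d := by
  have h1 := hA.2.2 a b c
  have h2 := hA.2.2 a b d
  have h3 := hA.2.2 c d a
  have h4 := hA.2.2 c d b
  rw [hs c b] at h1
  rw [hs d b] at h2
  rw [hs c a] at h3
  rw [hs c b] at h4
  simp only [min_le_iff] at *
  grind

theorem IsUltra.baseGram_rebase {v : ι → V} {ℓ : ι} (h : IsUltra (baseGram v ℓ)) (m : ι) :
    IsUltra (baseGram v m) := by
  have nonneg : ∀ m i j, 0 ≤ baseGram v m i j := by
    intro m i j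
    rw [_root_.baseGram_rebase v ℓ]
    have h1 := h.2.2 i j m
    have h2 := h.2.1 m i
    have h3 := h.2.1 m j
    rw [baseGram_symm v ℓ m i] at h2
    rcases min_le_iff.1 h1 with h1 | h1 <;> linarith
  refine ⟨nonneg m, fun i j => ?_, fun i j k => ?_⟩
  · have := baseGram_diag_sub v m i j
    have := nonneg i m j
    linarith
  · have h1 := h.four_point (baseGram_symm v ℓ) i j k m
    rw [_root_.baseGram_rebase v ℓ m i k, _root_.baseGram_rebase v ℓ m k j,
      _root_.baseGram_rebase v ℓ m i j]
    rw [min_le_iff] at h1 ⊢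
    have h2 := baseGram_symm v ℓ m j
    have h3 := baseGram_symm v ℓ m k
    have h4 := baseGram_symm v ℓ k j
    rcases h1 with h1 | h1
    · left; linarith
    · right; linarith

theorem NonobtuseTri.baseGram_nonneg {w : ι → V} {a b c : ι}
    (h : NonobtuseTri (w a) (w b) (w c)) :
    0 ≤ baseGram w a b c ∧ 0 ≤ baseGram w b a c ∧ 0 ≤ baseGram w c a b := h

theorem IsOrthProjTri.rotate {x p a b c : V} (h : IsOrthProjTri x p a b c) :
    IsOrthProjTri x p b c a := by
  obtain ⟨h1, h2, h3⟩ := h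
  refine ⟨?_, ?_, ?_⟩
  · convert h1 using 2
    ext y
    simp only [Set.mem_insert_iff, Set.mem_singleton_iff]
    tauto
  · simp only [inner_sub_right] at *
    linarith
  · simp only [inner_sub_right] at *
    linarith

theorem subOrthoSet_rotate {p a b c : V} (h : p ∈ SubOrthoSet a b c) : p ∈ SubOrthoSet b c a := by
  obtain ⟨x, h1, h2, h3, h4⟩ := h
  refine ⟨x, ?_, ?_, ?_, by tauto⟩
  · convert h1 using 2
    ext y
    simp only [Set.mem_insert_iff, Set.mem_singleton_iff]
    tauto
  · simp only [inner_sub_right, inner_sub_left] at *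
    linarith
  · simp only [inner_sub_right, inner_sub_left] at *
    linarith [real_inner_comm a b, real_inner_comm a c, real_inner_comm b c]

/-- If `x` projects onto the segment from `a` to the orthocenter `h` of `a b c`, then `x - a` has
the same inner product with both sides at `a`, bounded by that of the two sides. -/
theorem IsOrthProjTri.inner_eq_and_le {x p a b c h : V} (hp : IsOrthProjTri x p a b c)
    (ha : 0 ≤ ⟪b - a, c - a⟫) (hab : ⟪h - a, b - c⟫ = 0) (hbc : ⟪h - b, a - c⟫ = 0)
    (hs : p ∈ segment ℝ a h) :
    ⟪x - a, b - a⟫ = ⟪x - a, c - a⟫ ∧ ⟪x - a, b - a⟫ ≤ ⟪b - a, c - a⟫ := by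
  rw [segment_eq_image'] at hs
  obtain ⟨t, ⟨ht0, ht1⟩, rfl⟩ := hs
  obtain ⟨-, h2, h3⟩ := hp
  have e1 : ⟪h - a, c - a⟫ = ⟪b - a, c - a⟫ := by
    simp only [inner_sub_right, inner_sub_left] at *
    linarith
  have e2 : ⟪h - a, b - a⟫ = ⟪b - a, c - a⟫ := by
    rw [← e1]
    simp only [inner_sub_right, inner_sub_left] at *
    linarith
  have key : ∀ y, ⟪x - (a + t • (h - a)), y⟫ = ⟪x - a, y⟫ - t * ⟪h - a, y⟫ := by
    intro y
    rw [← real_inner_smul_left, ← inner_sub_left]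
    congr 1
    abel
  rw [key, e2] at h2
  rw [key, e1] at h3
  refine ⟨by linarith, by nlinarith⟩

theorem inner_cases_of_mem_subOrthoSet {x p a b c : V} (hn : NonobtuseTri a b c)
    (hp : IsOrthProjTri x p a b c) (hs : p ∈ SubOrthoSet a b c) :
    (⟪x - a, b - a⟫ = ⟪x - a, c - a⟫ ∧ ⟪x - a, b - a⟫ ≤ ⟪b - a, c - a⟫) ∨
    (⟪x - b, c - b⟫ = ⟪x - b, a - b⟫ ∧ ⟪x - b, c - b⟫ ≤ ⟪c - b, a - b⟫) ∨
    (⟪x - c, a - c⟫ = ⟪x - c, b - c⟫ ∧ ⟪x - c, a - c⟫ ≤ ⟪a - c, b - c⟫) := by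
  obtain ⟨ha, hb, hc⟩ := hn
  obtain ⟨h, -, h1, h2, h3⟩ := hs
  have h4 : ⟪h - c, b - a⟫ = 0 := by
    simp only [inner_sub_right, inner_sub_left] at *
    linarith [real_inner_comm a b, real_inner_comm a c, real_inner_comm b c]
  rcases h3 with h3 | h3 | h3
  · exact Or.inl (hp.inner_eq_and_le ha h1 h2 h3)
  · refine Or.inr (Or.inl (hp.rotate.inner_eq_and_le ?_ ?_ h4 h3))
    · rwa [real_inner_comm]
    · simp only [inner_sub_right] at *
      linarith
  · refine Or.inr (Or.inr (hp.rotate.rotate.inner_eq_and_le hc ?_ ?_ h3))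
    · simp only [inner_sub_right] at *
      linarith
    · simp only [inner_sub_right] at *
      linarith

theorem AffineIndependent.gram_det_ne_zero {a b c : V} (hi : AffineIndependent ℝ ![a, b, c]) :
    ⟪b - a, b - a⟫ * ⟪c - a, c - a⟫ - ⟪b - a, c - a⟫ ^ 2 ≠ 0 := by
  intro h0
  have hba : b - a ≠ 0 := by
    rw [sub_ne_zero]
    exact hi.injective.ne (show (1 : Fin 3) ≠ 0 by decide)
  have hU : ⟪b - a, b - a⟫ ≠ 0 := inner_self_ne_zero.2 hba
  have hz : ⟪b - a, c - a⟫ • (b - a) - ⟪b - a, b - a⟫ • (c - a) = 0 := by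
    rw [← inner_self_eq_zero (𝕜 := ℝ)]
    simp only [inner_sub_left (_ • _), inner_sub_right _ (_ • _), real_inner_smul_left,
      real_inner_smul_right, real_inner_comm (b - a) (c - a)]
    linear_combination ⟪b - a, b - a⟫ * h0
  rw [affineIndependent_iff_of_fintype] at hi
  have := hi ![⟪b - a, b - a⟫ - ⟪b - a, c - a⟫, ⟪b - a, c - a⟫, -⟪b - a, b - a⟫]
    (by simp [Fin.sum_univ_three]) (by
      rw [Finset.weightedVSub_eq_weightedVSubOfPoint_of_sum_eq_zero _ _ _
        (by simp [Fin.sum_univ_three]) a]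
      simpa [Finset.weightedVSubOfPoint_apply, Fin.sum_univ_three, ← sub_eq_add_neg]
        using hz) 2
  exact hU (by simpa using this)

theorem exists_proj_mem_subOrthoSet {x a b c : V} (hi : AffineIndependent ℝ ![a, b, c])
    (h0 : 0 ≤ ⟪x - a, b - a⟫) (he : ⟪x - a, b - a⟫ = ⟪x - a, c - a⟫)
    (hle : ⟪x - a, b - a⟫ ≤ ⟪b - a, c - a⟫) :
    ∃ p, IsOrthProjTri x p a b c ∧ p ∈ SubOrthoSet a b c := by
  have hD := hi.gram_det_ne_zero
  obtain ⟨t, ht0, ht1, ht⟩ : ∃ t : ℝ, 0 ≤ t ∧ t ≤ 1 ∧ ⟪x - a, b - a⟫ = t * ⟪b - a, c - a⟫ := by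
    rcases eq_or_ne ⟪b - a, c - a⟫ 0 with h | h
    · exact ⟨0, le_rfl, zero_le_one, by linarith⟩
    · have hpos : 0 < ⟪b - a, c - a⟫ := lt_of_le_of_ne (h0.trans hle) h.symm
      exact ⟨_, div_nonneg h0 hpos.le, (div_le_one hpos).2 hle, by field_simp⟩
  obtain ⟨q, hqa, hqb, hqc⟩ : ∃ q, a + q ∈ affineSpan ℝ ({a, b, c} : Set V) ∧
      ⟪q, b - a⟫ = ⟪b - a, c - a⟫ ∧ ⟪q, c - a⟫ = ⟪b - a, c - a⟫ := by
    generalize hα : ⟪b - a, c - a⟫ = α at hD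
    have hα' : ⟪c - a, b - a⟫ = α := by rw [real_inner_comm, hα]
    generalize hU : ⟪b - a, b - a⟫ = U at hD
    generalize hW : ⟪c - a, c - a⟫ = W at hD
    refine ⟨(α * (W - α) / (U * W - α ^ 2)) • (b - a) + (α * (U - α) / (U * W - α ^ 2)) • (c - a),
      ?_, ?_, ?_⟩
    · have ha : a ∈ affineSpan ℝ ({a, b, c} : Set V) := mem_affineSpan ℝ (by simp)
      have hb : b ∈ affineSpan ℝ ({a, b, c} : Set V) := mem_affineSpan ℝ (by simp)
      have hc : c ∈ affineSpan ℝ ({a, b, c} : Set V) := mem_affineSpan ℝ (by simp)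
      rw [add_comm]
      refine AffineSubspace.vadd_mem_of_mem_direction (Submodule.add_mem _ ?_ ?_) ha
      · exact Submodule.smul_mem _ _ (AffineSubspace.vsub_mem_direction hb ha)
      · exact Submodule.smul_mem _ _ (AffineSubspace.vsub_mem_direction hc ha)
    · rw [inner_add_left, real_inner_smul_left, real_inner_smul_left, hU, hα']
      rw [div_mul_eq_mul_div, div_mul_eq_mul_div, ← add_div, div_eq_iff hD]
      ring
    · rw [inner_add_left, real_inner_smul_left, real_inner_smul_left, hα, hW]
      rw [div_mul_eq_mul_div, div_mul_eq_mul_div, ← add_div, div_eq_iff hD]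
      ring
  have ha : a ∈ affineSpan ℝ ({a, b, c} : Set V) := mem_affineSpan ℝ (by simp)
  have key : ∀ y, ⟪x - (a + t • q), y⟫ = ⟪x - a, y⟫ - t * ⟪q, y⟫ := by
    intro y
    rw [← real_inner_smul_left, ← inner_sub_left]
    congr 1
    abel
  refine ⟨a + t • q, ⟨?_, ?_, ?_⟩, a + q, hqa, ?_, ?_, Or.inl ?_⟩
  · rw [add_comm]
    refine AffineSubspace.vadd_mem_of_mem_direction (Submodule.smul_mem _ _ ?_) ha
    simpa using AffineSubspace.vsub_mem_direction hqa ha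
  · rw [key, hqb, ht, sub_self]
  · rw [key, hqc, ← he, ht, sub_self]
  · rw [add_sub_cancel_left, ← sub_sub_sub_cancel_right b c a, inner_sub_right, hqb, hqc, sub_self]
  · have : ⟪a + q - b, a - c⟫ = ⟪b - a, c - a⟫ - ⟪q, c - a⟫ := by
      rw [← inner_sub_left, ← inner_neg_neg]
      congr 1 <;> abel
    rw [this, hqc, sub_self]
  · rw [segment_eq_image']
    exact ⟨t, ⟨ht0, ht1⟩, by simp⟩

theorem AffineIndependent.rotate {a b c : V} (hi : AffineIndependent ℝ ![a, b, c]) :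
    AffineIndependent ℝ ![b, c, a] := by
  convert hi.comp_embedding (finRotate 3).toEmbedding using 1
  ext i
  fin_cases i <;> rfl

theorem exists_proj_mem_subOrthoSet_of_isUltra {w : ι → V} {x a b c : ι}
    (hi : AffineIndependent ℝ ![w a, w b, w c]) (hu : IsUltra (baseGram w x)) :
    ∃ p, IsOrthProjTri (w x) p (w a) (w b) (w c) ∧ p ∈ SubOrthoSet (w a) (w b) (w c) := by
  have key : ∀ a b c : ι, AffineIndependent ℝ ![w a, w b, w c] →
      baseGram w x a b = baseGram w x a c → baseGram w x a b ≤ baseGram w x b c →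
      ∃ p, IsOrthProjTri (w x) p (w a) (w b) (w c) ∧ p ∈ SubOrthoSet (w a) (w b) (w c) := by
    intro a b c hi h1 h2
    have e1 := baseGram_diag_sub w x a b
    have e2 := baseGram_diag_sub w x a c
    have e3 := baseGram_rebase w x a b c
    have e4 := baseGram_symm w x a b
    refine exists_proj_mem_subOrthoSet hi ((hu.baseGram_rebase a).1 x b) ?_ ?_
    · change baseGram w a x b = baseGram w a x c
      linarith
    · change baseGram w a x b ≤ baseGram w a b c
      linarith
  have sab := baseGram_symm w x a b
  have sac := baseGram_symm w x a c
  have sbc := baseGram_symm w x b c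
  have h1 := hu.2.2 a b c
  have h2 := hu.2.2 b c a
  have h3 := hu.2.2 a c b
  have : (baseGram w x a b = baseGram w x a c ∧ baseGram w x a b ≤ baseGram w x b c) ∨
      (baseGram w x b c = baseGram w x b a ∧ baseGram w x b c ≤ baseGram w x c a) ∨
      (baseGram w x c a = baseGram w x c b ∧ baseGram w x c a ≤ baseGram w x a b) := by
    simp only [min_le_iff] at h1 h2 h3
    grind
  rcases this with ⟨h, h'⟩ | ⟨h, h'⟩ | ⟨h, h'⟩
  · exact key a b c hi h h'
  · obtain ⟨p, hp, hp'⟩ := key b c a hi.rotate h h'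
    exact ⟨p, hp.rotate.rotate, subOrthoSet_rotate (subOrthoSet_rotate hp')⟩
  · obtain ⟨p, hp, hp'⟩ := key c a b hi.rotate.rotate h h'
    exact ⟨p, hp.rotate, subOrthoSet_rotate hp'⟩

theorem IsUltra.isSubOrthoTetra {w : Fin 4 → V} (hw : AffineIndependent ℝ w)
    (hu : IsUltra (baseGram w 0)) : IsSubOrthoTetra w := by
  intro i
  refine ⟨⟨(hu.baseGram_rebase _).1 _ _, (hu.baseGram_rebase _).1 _ _,
    (hu.baseGram_rebase _).1 _ _⟩, exists_proj_mem_subOrthoSet_of_isUltra ?_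
    (hu.baseGram_rebase i)⟩
  convert hw.comp_embedding (Fin.succAboveEmb i) using 1
  ext j
  fin_cases j <;> rfl

theorem IsSubOrthoTetra.isUltra {w : Fin 4 → V} (h : IsSubOrthoTetra w) :
    IsUltra (baseGram w 0) := by
  have n0 : NonobtuseTri (w 1) (w 2) (w 3) := (h 0).1
  have n1 : NonobtuseTri (w 0) (w 2) (w 3) := (h 1).1
  have n2 : NonobtuseTri (w 0) (w 1) (w 3) := (h 2).1
  have n3 : NonobtuseTri (w 0) (w 1) (w 2) := (h 3).1
  obtain ⟨p, hp, hs⟩ := (h 0).2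
  have hc : (baseGram w 1 0 2 = baseGram w 1 0 3 ∧ baseGram w 1 0 2 ≤ baseGram w 1 2 3) ∨
      (baseGram w 2 0 3 = baseGram w 2 0 1 ∧ baseGram w 2 0 3 ≤ baseGram w 2 3 1) ∨
      (baseGram w 3 0 1 = baseGram w 3 0 2 ∧ baseGram w 3 0 1 ≤ baseGram w 3 1 2) :=
    inner_cases_of_mem_subOrthoSet n0 hp hs
  obtain ⟨a12, a13, a14⟩ := n1.baseGram_nonneg
  obtain ⟨a22, a23, a24⟩ := n2.baseGram_nonneg
  obtain ⟨a32, a33, a34⟩ := n3.baseGram_nonneg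
  have d1 := baseGram_diag_nonneg w 0 1
  have d2 := baseGram_diag_nonneg w 0 2
  have d3 := baseGram_diag_nonneg w 0 3
  have s12 := baseGram_symm w 0 2 1
  have s13 := baseGram_symm w 0 3 1
  have s23 := baseGram_symm w 0 3 2
  simp only [baseGram_rebase w 0 1, baseGram_rebase w 0 2, baseGram_rebase w 0 3,
    baseGram_self_left, s12, s13, s23] at a12 a13 a14 a22 a23 a24 a32 a33 a34 hc
  refine ⟨fun i j => ?_, fun i j => ?_, fun i j k => ?_⟩
  · fin_cases i <;> fin_cases j <;>
      simp [baseGram_self_left, baseGram_self_right, *]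
  · fin_cases i <;> fin_cases j <;>
      simp [baseGram_self_left, baseGram_self_right, s12, s13, s23] <;> linarith
  · fin_cases i <;> fin_cases j <;> fin_cases k <;>
      simp [baseGram_self_left, baseGram_self_right, s12, s13, s23] <;> grind

theorem isUltra_baseGram_comp {κ : Type*} {v : ι → V} {f : κ → ι} {k : κ}
    (h : IsUltra (baseGram v (f k))) : IsUltra (baseGram (v ∘ f) k) :=
  h.submatrix f

end InnerProduct

theorem isUltra_vGram_iff {n : ℕ} (v : Fin (n + 1) → EuclideanSpace ℝ (Fin n)) (ℓ : Fin (n + 1)) :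
    IsUltra (vGram v ℓ) ↔ IsUltra (baseGram v ℓ) := by
  refine ⟨fun h => ?_, fun h => h.submatrix Subtype.val⟩
  have nonneg : ∀ i j, 0 ≤ baseGram v ℓ i j := by
    intro i j
    by_cases hi : i = ℓ
    · rw [hi, baseGram_self_left]
    by_cases hj : j = ℓ
    · rw [hj, baseGram_self_right]
    exact h.1 ⟨i, hi⟩ ⟨j, hj⟩
  refine ⟨nonneg, fun i j => ?_, fun i j k => ?_⟩
  · by_cases hj : j = ℓ
    · rw [hj, baseGram_self_right]
      exact nonneg _ _
    by_cases hi : i = ℓ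
    · rw [hi, baseGram_self_left, baseGram_self_left]
    exact h.2.1 ⟨i, hi⟩ ⟨j, hj⟩
  · by_cases hi : i = ℓ
    · rw [hi, baseGram_self_left, baseGram_self_left]
      exact min_le_left _ _
    by_cases hj : j = ℓ
    · rw [hj, baseGram_self_right, baseGram_self_right]
      exact min_le_right _ _
    by_cases hk : k = ℓ
    · rw [hk, baseGram_self_right, baseGram_self_left, min_self]
      exact nonneg _ _
    exact h.2.2 ⟨i, hi⟩ ⟨j, hj⟩ ⟨k, hk⟩

theorem vecFour_eq_comp {α β : Type*} (v : α → β) (a b c d : α) :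
    ![v a, v b, v c, v d] = v ∘ ![a, b, c, d] := by
  ext i
  fin_cases i <;> rfl

theorem vecFour_injective {α : Type*} {a b c d : α} (hab : a ≠ b) (hac : a ≠ c) (had : a ≠ d)
    (hbc : b ≠ c) (hbd : b ≠ d) (hcd : c ≠ d) : Function.Injective ![a, b, c, d] := by
  intro i j
  fin_cases i <;> fin_cases j <;> simp <;> grind

theorem exists_vecFour_range {n : ℕ} (hn : 3 ≤ n) (ℓ i j k : Fin (n + 1)) :
    ∃ a b c : Fin (n + 1), a ≠ ℓ ∧ b ≠ ℓ ∧ c ≠ ℓ ∧ a ≠ b ∧ a ≠ c ∧ b ≠ c ∧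
      ∀ m ∈ ({i, j, k} : Finset (Fin (n + 1))), ∃ x, ![ℓ, a, b, c] x = m := by
  obtain ⟨T, h1, h2, h3⟩ := Finset.exists_subsuperset_card_eq
    (s := ({i, j, k} : Finset (Fin (n + 1))).erase ℓ) (t := Finset.univ.erase ℓ) (n := 3)
    (Finset.erase_subset_erase _ (Finset.subset_univ _))
    ((Finset.card_erase_le).trans Finset.card_le_three) (by simpa using hn)
  obtain ⟨a, b, c, hab, hac, hbc, rfl⟩ := Finset.card_eq_three.1 h3
  refine ⟨a, b, c, Finset.ne_of_mem_erase (h2 (by simp)), Finset.ne_of_mem_erase (h2 (by simp)),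
    Finset.ne_of_mem_erase (h2 (by simp)), hab, hac, hbc, fun m hm => ?_⟩
  by_cases hml : m = ℓ
  · exact ⟨0, hml.symm⟩
  · have := h1 (Finset.mem_erase.2 ⟨hml, hm⟩)
    simp only [Finset.mem_insert, Finset.mem_singleton] at this
    rcases this with rfl | rfl | rfl
    · exact ⟨1, rfl⟩
    · exact ⟨2, rfl⟩
    · exact ⟨3, rfl⟩

theorem stmt16 (n : ℕ) (hn : 3 ≤ n) (v : Fin (n + 1) → EuclideanSpace ℝ (Fin n))
    (hv : AffineIndependent ℝ v) :
    List.TFAE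
      [ ∃ ℓ, ∀ a b c : Fin (n + 1), a ≠ ℓ → b ≠ ℓ → c ≠ ℓ → a ≠ b → a ≠ c → b ≠ c →
          IsSubOrthoTetra ![v ℓ, v a, v b, v c],
        ∀ a b c d : Fin (n + 1), a ≠ b → a ≠ c → a ≠ d → b ≠ c → b ≠ d → c ≠ d →
          IsSubOrthoTetra ![v a, v b, v c, v d],
        ∃ ℓ, IsUltra (vGram v ℓ),
        ∀ ℓ, IsUltra (vGram v ℓ) ] := by
  tfae_have 4 → 2 := by
    intro h a b c d hab hac had hbc hbd hcd
    rw [vecFour_eq_comp]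
    exact IsUltra.isSubOrthoTetra
      (hv.comp_embedding ⟨_, vecFour_injective hab hac had hbc hbd hcd⟩)
      (isUltra_baseGram_comp ((isUltra_vGram_iff v a).1 (h a)))
  tfae_have 2 → 1 := fun h => ⟨0, fun a b c ha hb hc hab hac hbc =>
    h 0 a b c ha.symm hb.symm hc.symm hab hac hbc⟩
  tfae_have 1 → 3 := by
    rintro ⟨ℓ, h⟩
    refine ⟨ℓ, (isUltra_vGram_iff v ℓ).2 ?_⟩
    have key : ∀ i j k, 0 ≤ baseGram v ℓ i j ∧ baseGram v ℓ i j ≤ baseGram v ℓ i i ∧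
        min (baseGram v ℓ i k) (baseGram v ℓ k j) ≤ baseGram v ℓ i j := by
      intro i j k
      obtain ⟨a, b, c, ha, hb, hc, hab, hac, hbc, hm⟩ := exists_vecFour_range hn ℓ i j k
      have hu := (h a b c ha hb hc hab hac hbc).isUltra
      rw [vecFour_eq_comp] at hu
      obtain ⟨x, rfl⟩ := hm i (by simp)
      obtain ⟨y, rfl⟩ := hm j (by simp)
      obtain ⟨z, rfl⟩ := hm k (by simp)
      exact ⟨hu.1 x y, hu.2.1 x y, hu.2.2 x y z⟩
    exact ⟨fun i j => (key i j i).1, fun i j => (key i j i).2.1, fun i j k => (key i j k).2.2⟩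
  tfae_have 3 → 4 := fun ⟨ℓ, h⟩ m =>
    (isUltra_vGram_iff v m).2 (((isUltra_vGram_iff v ℓ).1 h).baseGram_rebase m)
  tfae_finish
end
end

section
/- Let v_0,…,v_4 be affinely independent points in ℝ^4 forming a 4-simplex. If four of its five tetrahedral facets (the tetrahedra spanned by four of the five vertices) are sub-orthocentric, then its fifth tetrahedral facet is sub-orthocentric as well. -/
open Matrix Finset
open scoped RealInnerProductSpace

noncomputable section

/-- The four-point inequality (for tree metrics) at `i, j, k, l`. -/
def FourPoint {ι : Type*} (d : ι → ι → ℝ) (i j k l : ι) : Prop :=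
  d i j + d k l ≤ max (d i k + d j l) (d i l + d j k)

/-- The four-point inequality for all quadruples containing a base point `m` implies it for
all quadruples. -/
theorem FourPoint.of_basepoint {ι : Type*} {d : ι → ι → ℝ} (hd : ∀ i j, d i j = d j i) {m : ι}
    (h : ∀ i j k, FourPoint d m i j k) (i j k l : ι) : FourPoint d i j k l := by
  have key : ∀ x y z, min (d m x + d m z - d x z) (d m z + d m y - d z y) ≤
      d m x + d m y - d x y := by
    intro x y z
    have := h z x y
    unfold FourPoint at this
    rw [hd z x, hd z y] at this
    rcases le_max_iff.1 this with h | h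
    · exact min_le_iff.2 (Or.inr (by linarith [hd z y]))
    · exact min_le_iff.2 (Or.inl (by linarith [hd z y]))
  have h1 := key i j k
  have h2 := key i j l
  have h3 := key k l i
  have h4 := key k l j
  unfold FourPoint
  simp only [min_le_iff, le_max_iff] at *
  simp only [hd k i, hd k j, hd l j] at *
  by_contra! hcon
  obtain ⟨hcon, hcon'⟩ := hcon
  rcases h1 with h1 | h1 <;> rcases h2 with h2 | h2 <;> rcases h3 with h3 | h3 <;>
    rcases h4 with h4 | h4 <;> linarith

section SqDist

variable {V : Type*} [NormedAddCommGroup V]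

/-- The squared distance. -/
def sqDist (x y : V) : ℝ := ‖x - y‖ ^ 2

theorem sqDist_comm (x y : V) : sqDist x y = sqDist y x := by
  rw [sqDist, sqDist, norm_sub_rev]

@[simp] theorem sqDist_self (x : V) : sqDist x x = 0 := by simp [sqDist]

theorem sqDist_nonneg (x y : V) : 0 ≤ sqDist x y := sq_nonneg _

end SqDist

section Tetra

variable {V : Type*} [NormedAddCommGroup V] [InnerProductSpace ℝ V]

theorem inner_sub_sub_eq_sqDist (x a y b : V) :
    ⟪x - a, y - b⟫ = (sqDist x b + sqDist a y - sqDist x y - sqDist a b) / 2 := by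
  simp only [sqDist, norm_sub_sq_real, inner_sub_left, inner_sub_right]
  ring

theorem inner_sub_eq_zero_swap {x y z : V} (h : ⟪x, y - z⟫ = 0) : ⟪x, z - y⟫ = 0 := by
  rw [← neg_sub y z, inner_neg_right, h, neg_zero]

theorem nonobtuseTri_iff (a b c : V) : NonobtuseTri a b c ↔
    sqDist b c ≤ sqDist a b + sqDist a c ∧ sqDist a c ≤ sqDist a b + sqDist b c ∧
      sqDist a b ≤ sqDist a c + sqDist b c := by
  simp only [NonobtuseTri, inner_sub_sub_eq_sqDist, sqDist_self, sqDist_comm b a,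
    sqDist_comm c b]
  constructor <;> rintro ⟨h1, h2, h3⟩ <;> refine ⟨?_, ?_, ?_⟩ <;> linarith

/-- The orthogonal projection of `u` onto the plane of `a b c` lies in the sub-orthocentric set. -/
def ProjSubOrtho (u a b c : V) : Prop :=
  ∃ p, IsOrthProjTri u p a b c ∧ p ∈ SubOrthoSet a b c

theorem ProjSubOrtho.swap_left {u a b c : V} (h : ProjSubOrtho u a b c) :
    ProjSubOrtho u b a c := by
  obtain ⟨p, ⟨hp, hb, hc⟩, o, ho, ha', hb', hx⟩ := h
  refine ⟨p, ⟨by rwa [Set.insert_comm], ?_, ?_⟩, o, by rwa [Set.insert_comm], hb', ha', by tauto⟩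
  · exact inner_sub_eq_zero_swap hb
  · rw [← sub_sub_sub_cancel_right c b a, inner_sub_right, hb, hc, sub_zero]

theorem ProjSubOrtho.swap_right {u a b c : V} (h : ProjSubOrtho u a b c) :
    ProjSubOrtho u a c b := by
  obtain ⟨p, ⟨hp, hb, hc⟩, o, ho, ha', hb', hx⟩ := h
  refine ⟨p, ⟨by rwa [Set.pair_comm], hc, hb⟩, o, by rwa [Set.pair_comm], ?_, ?_, by tauto⟩
  · exact inner_sub_eq_zero_swap ha'
  · rw [inner_sub_sub_eq_sqDist] at *
    linarith [sqDist_comm a b, sqDist_comm a c, sqDist_comm b c]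

theorem inner_of_mem_segment_orthocenter {u p a b c o : V} (hg : 0 ≤ ⟪b - a, c - a⟫)
    (hb : ⟪u - p, b - a⟫ = 0) (hc : ⟪u - p, c - a⟫ = 0)
    (ha' : ⟪o - a, b - c⟫ = 0) (hb' : ⟪o - b, a - c⟫ = 0) (hp : p ∈ segment ℝ a o) :
    ⟪u - a, b - a⟫ = ⟪u - a, c - a⟫ ∧ ⟪u - a, b - a⟫ ≤ ⟪b - a, c - a⟫ := by
  rw [segment_eq_image'] at hp
  obtain ⟨t, ⟨ht0, ht1⟩, rfl⟩ := hp
  have h1 : ⟪o - a, c - a⟫ = ⟪b - a, c - a⟫ := by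
    rw [← sub_add_sub_cancel o b a, inner_add_left, inner_sub_eq_zero_swap hb', zero_add]
  have h2 : ⟪o - a, b - a⟫ = ⟪b - a, c - a⟫ := by
    rw [← sub_add_sub_cancel b c a, inner_add_right, ha', zero_add, h1, sub_add_sub_cancel]
  rw [← sub_sub, inner_sub_left, real_inner_smul_left] at hb hc
  rw [h2] at hb
  rw [h1] at hc
  constructor
  · linarith
  · nlinarith

theorem FourPoint.of_projSubOrtho {u a b c : V} (hT : NonobtuseTri a b c)
    (h : ProjSubOrtho u a b c) :
    FourPoint sqDist u a b c ∧ FourPoint sqDist u b a c ∧ FourPoint sqDist u c a b := by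
  obtain ⟨h1, h2, h3⟩ := hT
  obtain ⟨p, ⟨hp, hb, hc⟩, o, ho, ha', hb', hx⟩ := h
  have hbc : ⟪u - p, c - b⟫ = 0 := by
    rw [← sub_sub_sub_cancel_right c b a, inner_sub_right, hb, hc, sub_zero]
  have hcc : ⟪o - c, a - b⟫ = 0 := by
    rw [inner_sub_sub_eq_sqDist] at *
    linarith [sqDist_comm a b, sqDist_comm a c, sqDist_comm b c]
  have key : (⟪u - a, b - a⟫ = ⟪u - a, c - a⟫ ∧ ⟪u - a, b - a⟫ ≤ ⟪b - a, c - a⟫) ∨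
      (⟪u - b, a - b⟫ = ⟪u - b, c - b⟫ ∧ ⟪u - b, a - b⟫ ≤ ⟪a - b, c - b⟫) ∨
      (⟪u - c, a - c⟫ = ⟪u - c, b - c⟫ ∧ ⟪u - c, a - c⟫ ≤ ⟪a - c, b - c⟫) := by
    rcases hx with hx | hx | hx
    · exact .inl (inner_of_mem_segment_orthocenter h1 hb hc ha' hb' hx)
    · exact .inr (.inl (inner_of_mem_segment_orthocenter h2 (inner_sub_eq_zero_swap hb) hbc hb' ha' hx))
    · exact .inr (.inr (inner_of_mem_segment_orthocenter h3 (inner_sub_eq_zero_swap hc)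
        (inner_sub_eq_zero_swap hbc) hcc (inner_sub_eq_zero_swap ha') hx))
  simp only [inner_sub_sub_eq_sqDist, sqDist_self, sqDist_comm b a, sqDist_comm c a,
    sqDist_comm c b] at key
  simp only [FourPoint, le_max_iff, sqDist_comm b a, sqDist_comm c a, sqDist_comm c b]
  rcases key with ⟨h1, h2⟩ | ⟨h1, h2⟩ | ⟨h1, h2⟩ <;> refine ⟨?_, ?_, ?_⟩ <;>
    first | (left; linarith) | (right; linarith)

theorem ProjSubOrtho.of_inner {u a b c : V}
    (hdet : 0 < ⟪b - a, b - a⟫ * ⟪c - a, c - a⟫ - ⟪b - a, c - a⟫ ^ 2)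
    (h0 : 0 ≤ ⟪u - a, b - a⟫) (h1 : ⟪u - a, b - a⟫ = ⟪u - a, c - a⟫)
    (h2 : ⟪u - a, b - a⟫ ≤ ⟪b - a, c - a⟫) : ProjSubOrtho u a b c := by
  set B := ⟪b - a, b - a⟫ with hB
  set C := ⟪c - a, c - a⟫ with hC
  set g := ⟪b - a, c - a⟫ with hg
  set r := ⟪u - a, b - a⟫ with hr
  obtain ⟨t, ht0, ht1, htg⟩ : ∃ t : ℝ, 0 ≤ t ∧ t ≤ 1 ∧ t * g = r := by
    rcases (h0.trans h2).eq_or_lt with h | h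
    · exact ⟨0, le_rfl, zero_le_one, by linarith⟩
    · exact ⟨r / g, div_nonneg h0 h.le, (div_le_one h).2 h2, div_mul_cancel₀ _ h.ne'⟩
  set D := B * C - g ^ 2 with hD
  set w : V := (g * (C - g) / D) • (b - a) + (g * (B - g) / D) • (c - a) with hw
  have hwb : ⟪w, b - a⟫ = g := by
    rw [hw, inner_add_left, real_inner_smul_left, real_inner_smul_left, real_inner_comm, ← hB,
      real_inner_comm, ← hg]
    field_simp
    rw [hD]; ring
  have hwc : ⟪w, c - a⟫ = g := by
    rw [hw, inner_add_left, real_inner_smul_left, real_inner_smul_left, ← hC, ← hg]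
    field_simp
    rw [hD]; ring
  have hmem : ∀ s : ℝ, a + s • w ∈ affineSpan ℝ ({a, b, c} : Set V) := by
    intro s
    have ha : a ∈ affineSpan ℝ ({a, b, c} : Set V) := subset_affineSpan _ _ (by simp)
    have hb : b ∈ affineSpan ℝ ({a, b, c} : Set V) := subset_affineSpan _ _ (by simp)
    have hc : c ∈ affineSpan ℝ ({a, b, c} : Set V) := subset_affineSpan _ _ (by simp)
    have : s • w ∈ (affineSpan ℝ ({a, b, c} : Set V)).direction :=
      Submodule.smul_mem _ _ (Submodule.add_mem _
        (Submodule.smul_mem _ _ (AffineSubspace.vsub_mem_direction hb ha))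
        (Submodule.smul_mem _ _ (AffineSubspace.vsub_mem_direction hc ha)))
    rw [add_comm]
    exact AffineSubspace.vadd_mem_of_mem_direction this ha
  refine ⟨a + t • w, ⟨hmem t, ?_, ?_⟩, a + w, by simpa using hmem 1, ?_, ?_, .inl ?_⟩
  · rw [← sub_sub, inner_sub_left, real_inner_smul_left, hwb, htg, sub_self]
  · rw [← sub_sub, inner_sub_left, real_inner_smul_left, hwc, htg, ← h1, sub_self]
  · rw [add_sub_cancel_left, ← sub_sub_sub_cancel_right b c a, inner_sub_right, hwb, hwc, sub_self]
  · rw [← neg_sub c a, inner_neg_right, add_comm a w, add_sub_assoc, ← neg_sub b a,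
      inner_add_left, inner_neg_left, hwc, ← hg]
    ring
  · rw [segment_eq_image']
    exact ⟨t, ⟨ht0, ht1⟩, by simp⟩

theorem AffineIndependent.gram_pos {ι : Type*} {w : ι → V} (hw : AffineIndependent ℝ w)
    {i j k : ι} (hij : i ≠ j) (hik : i ≠ k) (hjk : j ≠ k) :
    0 < ⟪w j - w i, w j - w i⟫ * ⟪w k - w i, w k - w i⟫ - ⟪w j - w i, w k - w i⟫ ^ 2 := by
  have hlin := (affineIndependent_iff_linearIndependent_vsub ℝ w i).1 hw
  have hinj : Function.Injective ![(⟨j, hij.symm⟩ : {x // x ≠ i}), ⟨k, hik.symm⟩] := by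
    intro x y hxy
    fin_cases x <;> fin_cases y <;> simp_all
  have hpair := hlin.comp _ hinj
  have hli : LinearIndependent ℝ ![w j - w i, w k - w i] := by
    have heq : ![w j - w i, w k - w i] = (fun x : {x // x ≠ i} => w x -ᵥ w i) ∘
        ![⟨j, hij.symm⟩, ⟨k, hik.symm⟩] := by
      ext x
      fin_cases x <;> rfl
    rw [heq]
    exact hpair
  rw [LinearIndependent.pair_iff] at hli
  set x := w j - w i
  set y := w k - w i
  have hy : 0 < ⟪y, y⟫ := by
    refine real_inner_self_pos.2 fun h => ?_
    simpa using (hli 0 1 (by simp [h])).2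
  have hne : ⟪y, y⟫ • x + (-⟪x, y⟫) • y ≠ 0 := fun h => hy.ne' (hli _ _ h).1
  have hpos := real_inner_self_pos.2 hne
  have hexp : ⟪⟪y, y⟫ • x + (-⟪x, y⟫) • y, ⟪y, y⟫ • x + (-⟪x, y⟫) • y⟫ =
      ⟪y, y⟫ * (⟪x, x⟫ * ⟪y, y⟫ - ⟪x, y⟫ ^ 2) := by
    simp only [inner_add_left, inner_add_right, real_inner_smul_left, real_inner_smul_right,
      real_inner_comm x y]
    ring
  rw [hexp] at hpos
  exact pos_of_mul_pos_right hpos hy.le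

theorem IsSubOrthoTetra.nonobtuseTri {w : Fin 4 → V} (h : IsSubOrthoTetra w) {i j k : Fin 4}
    (hij : i ≠ j) (hik : i ≠ k) (hjk : j ≠ k) : NonobtuseTri (w i) (w j) (w k) := by
  obtain ⟨l, hl⟩ : ∃ l, l ≠ i ∧ l ≠ j ∧ l ≠ k := by
    revert i j k; decide
  obtain ⟨i, rfl⟩ := Fin.exists_succAbove_eq hl.1.symm
  obtain ⟨j, rfl⟩ := Fin.exists_succAbove_eq hl.2.1.symm
  obtain ⟨k, rfl⟩ := Fin.exists_succAbove_eq hl.2.2.symm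
  have := (nonobtuseTri_iff _ _ _).1 (h l).1
  rw [nonobtuseTri_iff]
  obtain ⟨h1, h2, h3⟩ := this
  fin_cases i <;> fin_cases j <;> fin_cases k <;> simp at hij hik hjk <;>
    simp only [Fin.zero_eta, Fin.mk_one, Fin.reduceFinMk,
      sqDist_comm (w (l.succAbove 1)) (w (l.succAbove 0)),
      sqDist_comm (w (l.succAbove 2)) (w (l.succAbove 0)),
      sqDist_comm (w (l.succAbove 2)) (w (l.succAbove 1))] <;>
    refine ⟨?_, ?_, ?_⟩ <;> linarith

theorem IsSubOrthoTetra.sqDist_le {w : Fin 4 → V} (h : IsSubOrthoTetra w) (i j k : Fin 4) :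
    sqDist (w i) (w j) ≤ sqDist (w i) (w k) + sqDist (w k) (w j) := by
  have n1 := sqDist_nonneg (w i) (w k)
  have n2 := sqDist_nonneg (w k) (w j)
  by_cases hij : i = j
  · subst hij; simp only [sqDist_self]; linarith
  by_cases hik : i = k
  · subst hik; simp
  by_cases hjk : j = k
  · subst hjk; simp
  have := ((nonobtuseTri_iff _ _ _).1 (h.nonobtuseTri hij hik hjk)).2.2
  rwa [sqDist_comm (w k)]

theorem IsSubOrthoTetra.fourPoint {w : Fin 4 → V} (h : IsSubOrthoTetra w) (i j k l : Fin 4) :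
    FourPoint sqDist (w i) (w j) (w k) (w l) := by
  by_cases hij : i = j
  · subst hij
    simp only [FourPoint, sqDist_self, zero_add, le_max_iff]
    left
    linarith [h.sqDist_le k l i, sqDist_comm (w i) (w k)]
  by_cases hik : i = k
  · subst hik
    simp only [FourPoint, le_max_iff]
    right
    linarith [sqDist_comm (w i) (w j)]
  by_cases hil : i = l
  · subst hil
    simp only [FourPoint, le_max_iff]
    left
    linarith [sqDist_comm (w i) (w j), sqDist_comm (w i) (w k)]
  obtain ⟨j, rfl⟩ := Fin.exists_succAbove_eq (Ne.symm hij)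
  obtain ⟨k, rfl⟩ := Fin.exists_succAbove_eq (Ne.symm hik)
  obtain ⟨l, rfl⟩ := Fin.exists_succAbove_eq (Ne.symm hil)
  by_cases hjk : j = k
  · subst hjk
    simp only [FourPoint, le_max_iff]
    left
    linarith
  by_cases hjl : j = l
  · subst hjl
    simp only [FourPoint, le_max_iff]
    right
    linarith [sqDist_comm (w (i.succAbove k)) (w (i.succAbove j))]
  by_cases hkl : k = l
  · subst hkl
    simp only [FourPoint, le_max_iff, sqDist_self]
    left
    linarith [h.sqDist_le i (i.succAbove j) (i.succAbove k),
      sqDist_comm (w (i.succAbove k)) (w (i.succAbove j))]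
  obtain ⟨h1, h2, h3⟩ := FourPoint.of_projSubOrtho (h i).1 (h i).2
  simp only [FourPoint, le_max_iff, sqDist_comm (w (i.succAbove 1)) (w (i.succAbove 0)),
    sqDist_comm (w (i.succAbove 2)) (w (i.succAbove 0)),
    sqDist_comm (w (i.succAbove 2)) (w (i.succAbove 1))] at h1 h2 h3
  fin_cases j <;> fin_cases k <;> fin_cases l <;> simp at hjk hjl hkl <;>
    simp only [Fin.zero_eta, Fin.mk_one, Fin.reduceFinMk, FourPoint, le_max_iff,
      sqDist_comm (w (i.succAbove 1)) (w (i.succAbove 0)),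
      sqDist_comm (w (i.succAbove 2)) (w (i.succAbove 0)),
      sqDist_comm (w (i.succAbove 2)) (w (i.succAbove 1))] <;> tauto

theorem IsSubOrthoTetra.of_fourPoint {w : Fin 4 → V} (hw : AffineIndependent ℝ w)
    (h : ∀ i j k l, FourPoint sqDist (w i) (w j) (w k) (w l)) : IsSubOrthoTetra w := by
  have htri : ∀ i j k, sqDist (w i) (w j) ≤ sqDist (w i) (w k) + sqDist (w k) (w j) := by
    intro i j k
    have := h i j k k
    simpa [FourPoint, sqDist_comm (w j) (w k)] using this
  intro i
  have hne : ∀ x : Fin 3, i.succAbove x ≠ i := Fin.succAbove_ne i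
  have h01 : i.succAbove 0 ≠ i.succAbove 1 := by simp
  have h02 : i.succAbove 0 ≠ i.succAbove 2 := by simp
  have h12 : i.succAbove 1 ≠ i.succAbove 2 := by simp
  generalize i.succAbove 0 = a at *
  generalize i.succAbove 1 = b at *
  generalize i.succAbove 2 = c at *
  refine ⟨(nonobtuseTri_iff _ _ _).2 ⟨?_, htri _ _ _, ?_⟩, ?_⟩
  · rw [sqDist_comm (w a) (w b)]; exact htri _ _ _
  · rw [sqDist_comm (w b) (w c)]; exact htri _ _ _
  have ga := hw.gram_pos h01 h02 h12
  have gb := hw.gram_pos h01.symm h12 h02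
  have gc := hw.gram_pos h02.symm h12.symm h01
  have f1 := h i a b c
  have f2 := h i b a c
  have f3 := h i c a b
  have t1 := htri i b a
  have t2 := htri i a b
  have t3 := htri i a c
  simp only [FourPoint, le_max_iff, sqDist_comm (w b) (w a), sqDist_comm (w c) (w a),
    sqDist_comm (w c) (w b)] at f1 f2 f3 t1 t2 t3
  have key : (sqDist (w i) (w a) + sqDist (w b) (w c) ≤ sqDist (w i) (w b) + sqDist (w a) (w c) ∧
      sqDist (w i) (w b) + sqDist (w a) (w c) = sqDist (w i) (w c) + sqDist (w a) (w b)) ∨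
      (sqDist (w i) (w b) + sqDist (w a) (w c) ≤ sqDist (w i) (w a) + sqDist (w b) (w c) ∧
      sqDist (w i) (w a) + sqDist (w b) (w c) = sqDist (w i) (w c) + sqDist (w a) (w b)) ∨
      (sqDist (w i) (w c) + sqDist (w a) (w b) ≤ sqDist (w i) (w a) + sqDist (w b) (w c) ∧
      sqDist (w i) (w a) + sqDist (w b) (w c) = sqDist (w i) (w b) + sqDist (w a) (w c)) := by
    grind
  change ProjSubOrtho _ _ _ _
  rcases key with ⟨k1, k2⟩ | ⟨k1, k2⟩ | ⟨k1, k2⟩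
  · apply ProjSubOrtho.of_inner ga <;> simp only [inner_sub_sub_eq_sqDist, sqDist_self,
      sqDist_comm (w b) (w a)] <;> linarith
  · apply ProjSubOrtho.swap_left
    apply ProjSubOrtho.of_inner gb <;> simp only [inner_sub_sub_eq_sqDist, sqDist_self,
      sqDist_comm (w b) (w a)] <;> linarith
  · apply ProjSubOrtho.swap_right
    apply ProjSubOrtho.swap_left
    apply ProjSubOrtho.of_inner gc <;> simp only [inner_sub_sub_eq_sqDist, sqDist_self,
      sqDist_comm (w c) (w a), sqDist_comm (w c) (w b)] <;> linarith

end Tetra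

theorem stmt19 (v : Fin 5 → EuclideanSpace ℝ (Fin 4)) (hv : AffineIndependent ℝ v)
    (m : Fin 5) (h : ∀ ℓ, ℓ ≠ m → IsSubOrthoTetra (fun i => v (ℓ.succAbove i))) :
    IsSubOrthoTetra (fun i => v (m.succAbove i)) := by
  have hbase : ∀ i j k, FourPoint (fun x y => sqDist (v x) (v y)) m i j k := by
    intro i j k
    obtain ⟨l, hm, hi, hj, hk⟩ : ∃ l, l ≠ m ∧ l ≠ i ∧ l ≠ j ∧ l ≠ k := by
      obtain ⟨l, hl⟩ := Finset.exists_mem_notMem_of_card_lt_card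
        (s := {m, i, j, k}) (t := (Finset.univ : Finset (Fin 5)))
        (Finset.card_le_four.trans_lt (by simp))
      exact ⟨l, by simpa using hl⟩
    obtain ⟨m', hm'⟩ := Fin.exists_succAbove_eq hm.symm
    obtain ⟨i', hi'⟩ := Fin.exists_succAbove_eq hi.symm
    obtain ⟨j', hj'⟩ := Fin.exists_succAbove_eq hj.symm
    obtain ⟨k', hk'⟩ := Fin.exists_succAbove_eq hk.symm
    have := (h l hm).fourPoint m' i' j' k'
    simpa only [FourPoint, hm', hi', hj', hk'] using this
  exact IsSubOrthoTetra.of_fourPoint (hv.comp_embedding m.succAboveEmb)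
    fun i j k l => FourPoint.of_basepoint (fun _ _ => sqDist_comm _ _) hbase _ _ _ _
end
end
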